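/- Let N ≥ 2 be an integer that admits at least one N-solution, and let x_1 < x_2 < ⋯ be the first coordinates of all N-solutions. Then the sum Σ_{i ≥ 2} 1/x_i (i.e., the sum of 1/x over all N-solutions (x, m) with x > x_1) is strictly less than 5.9037. -/

import Mathlib

/-- For an integer `N ≥ 2`, a pair `(x, m)` with `x ≥ 2`, `m ≥ 2` is an `N`-solution if
`(x^m - 1)/(x - 1) = 1 + x + ⋯ + x^(m-1) = N`. -/
def IsNSol (N x m : ℕ) : Prop :=
  2 ≤ x ∧ 2 ≤ m ∧ ∑ i ∈ Finset.range m, x ^ i = N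

section

open Polynomial

theorem dvd_iterate_fwdDiff_mul_pow (g β : ℤ) (hβ : g ∣ β - 1) (A M : ℕ) (P : ℕ → ℤ)
    (hP : (fwdDiff 1)^[A] P = 0) (z : ℕ) :
    g ^ M ∣ (fwdDiff 1)^[A + M] (fun z => P z * β ^ z) z := by
  obtain ⟨t, ht⟩ := hβ
  induction h : A + M generalizing A M P with
  | zero =>
    obtain rfl : M = 0 := by omega
    simp
  | succ k ih =>
    have hstep : fwdDiff 1 (fun z => P z * β ^ z) =
        β • (fun z => fwdDiff 1 P z * β ^ z) + (g * t) • (fun z => P z * β ^ z) := by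
      funext z
      simp only [fwdDiff, Pi.add_apply, Pi.smul_apply, smul_eq_mul, ← ht]
      ring
    rw [Function.iterate_succ_apply, hstep, fwdDiff_iter_add, fwdDiff_iter_const_smul,
      fwdDiff_iter_const_smul]
    simp only [Pi.add_apply, Pi.smul_apply, smul_eq_mul]
    refine dvd_add ?_ ?_
    · rcases A with _ | A
      · have hP0 : P = 0 := hP
        have : (fun z => fwdDiff 1 P z * β ^ z) = (0 : ℤ) • fun _ : ℕ => (0 : ℤ) := by
          funext z; simp [hP0, fwdDiff]
        rw [this, fwdDiff_iter_const_smul]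
        simp
      · exact Dvd.dvd.mul_left (ih A M (fwdDiff 1 P) hP (by omega)) _
    · rcases M with _ | M
      · simp
      · rw [pow_succ', mul_assoc]
        exact mul_dvd_mul_left _ (Dvd.dvd.mul_left (ih A M P hP (by omega)) _)

theorem dvd_of_dvd_iterate_fwdDiff (F : ℕ → ℤ) (D : ℤ) (K : ℕ)
    (hF : ∀ z, D ∣ (fwdDiff 1)^[K] F z) (h0 : ∀ z < K, D ∣ F z) (z : ℕ) : D ∣ F z := by
  induction z using Nat.strong_induction_on with
  | _ z ih =>
    rcases lt_or_ge z K with h | h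
    · exact h0 z h
    obtain ⟨y, rfl⟩ := Nat.exists_eq_add_of_le' h
    have h1 := hF y
    rw [fwdDiff_iter_eq_sum_shift, Finset.sum_range_succ] at h1
    have h2 : D ∣ ∑ k ∈ Finset.range K, ((-1 : ℤ) ^ (K - k) * K.choose k) • F (y + k • 1) := by
      refine Finset.dvd_sum fun k hk => ?_
      have := Finset.mem_range.1 hk
      exact Dvd.dvd.mul_left (ih _ (by simp; omega)) _
    simpa using (dvd_add_right h2).1 h1

theorem pow_dvd_sum_eval_mul_pow (g : ℤ) {A C M : ℕ} (P : Fin C → ℤ[X])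
    (hP : ∀ c, (P c).natDegree < A) (β : ℤ) (hβ : g ∣ β - 1)
    (h0 : ∀ z : ℕ, z < A + M → g ^ M ∣ ∑ c, (P c).eval (z : ℤ) * β ^ ((c : ℕ) * z)) (z : ℕ) :
    g ^ M ∣ ∑ c, (P c).eval (z : ℤ) * β ^ ((c : ℕ) * z) := by
  refine dvd_of_dvd_iterate_fwdDiff (fun z : ℕ => ∑ c, (P c).eval (z : ℤ) * β ^ ((c : ℕ) * z))
    _ (A + M) (fun z => ?_) h0 z
  have : (fun z : ℕ => ∑ c, (P c).eval (z : ℤ) * β ^ ((c : ℕ) * z)) =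
      ∑ c, fun z : ℕ => (P c).eval (z : ℤ) * (β ^ (c : ℕ)) ^ z := by
    funext z; simp [pow_mul]
  rw [this, fwdDiff_iter_finsetSum, Finset.sum_apply]
  refine Finset.dvd_sum fun c _ => dvd_iterate_fwdDiff_mul_pow g _ ?_ A M _ ?_ z
  · exact hβ.trans (by simpa using sub_dvd_pow_sub_pow β 1 (c : ℕ))
  · have h := Polynomial.fwdDiff_iter_eq_zero_of_degree_lt (hP c)
    funext y
    have h2 := congrFun h (y : ℤ)
    rw [fwdDiff_iter_eq_sum_shift] at h2 ⊢
    simpa using h2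

theorem coeff_prod_sum_of_natDegree_le {R ι : Type*} [CommRing R] (s : Finset ι) (f : ι → R[X])
    (d : ι → ℕ) (h : ∀ i ∈ s, (f i).natDegree ≤ d i) :
    (∏ i ∈ s, f i).coeff (∑ i ∈ s, d i) = ∏ i ∈ s, (f i).coeff (d i) := by
  classical
  induction s using Finset.induction_on with
  | empty => simp
  | insert a s ha ih =>
    rw [Finset.prod_insert ha, Finset.sum_insert ha, Finset.prod_insert ha,
      coeff_mul_add_eq_of_natDegree_le (h a (Finset.mem_insert_self a s)),
      ih fun i hi => h i (Finset.mem_insert_of_mem hi)]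
    exact (natDegree_prod_le _ _).trans
      (Finset.sum_le_sum fun i hi => h i (Finset.mem_insert_of_mem hi))

theorem coeff_det_sum_of_natDegree_le {R ι : Type*} [CommRing R] [Fintype ι] [DecidableEq ι]
    (N : Matrix ι ι R[X]) (d : ι → ℕ) (h : ∀ i j, (N i j).natDegree ≤ d j) :
    N.det.coeff (∑ j, d j) = (Matrix.of fun i j => (N i j).coeff (d j)).det := by
  rw [Matrix.det_apply, Matrix.det_apply, finsetSum_coeff]
  refine Finset.sum_congr rfl fun σ _ => ?_
  rw [coeff_smul, coeff_prod_sum_of_natDegree_le _ _ _ fun i _ => h _ i]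
  rfl

theorem natDegree_det_le_sum {R ι : Type*} [CommRing R] [Fintype ι] [DecidableEq ι]
    (N : Matrix ι ι R[X]) (d : ι → ℕ) (h : ∀ i j, (N i j).natDegree ≤ d j) :
    N.det.natDegree ≤ ∑ j, d j := by
  rw [Matrix.det_apply]
  refine natDegree_sum_le_of_forall_le _ _ fun σ _ => (natDegree_smul_le _ _).trans ?_
  exact (natDegree_prod_le _ _).trans (Finset.sum_le_sum fun i _ => h _ i)

/-- A zero estimate for polynomials on the product of the additive and the multiplicative group. -/
theorem card_lt_of_sum_eval_mul_pow_eq_zero {A C : ℕ} (P : Fin C → ℤ[X])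
    (hP : ∀ c, (P c).natDegree < A) (hne : ∃ c, P c ≠ 0) (b : ℤ) (hb : 2 ≤ b) (Z : Finset ℤ)
    (w : ℤ → Fin C → ℤ) (hw : ∀ z ∈ Z, ∀ c, w z c ≠ 0)
    (h : ∀ z ∈ Z, ∀ j < C, ∑ c, (P c).eval (z + j) * b ^ (j * (c : ℕ)) * w z c = 0) :
    Z.card < A * C := by
  classical
  set s : Finset (Fin C) := Finset.univ.filter fun c => P c ≠ 0 with hs
  set r := s.card with hr
  let e : Fin r ↪o Fin C := s.orderEmbOfFin rfl
  have he : ∀ i, P (e i) ≠ 0 := fun i =>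
    (Finset.mem_filter.1 (s.orderEmbOfFin_mem rfl i)).2
  have hrC : r ≤ C := by simpa using s.card_le_univ
  have hr0 : 0 < r := by
    obtain ⟨c, hc⟩ := hne
    exact Finset.card_pos.2 ⟨c, by simpa [hs] using hc⟩
  let N : Matrix (Fin r) (Fin r) ℤ[X] := Matrix.of fun j i =>
    Polynomial.C (b ^ ((j : ℕ) * (e i : ℕ))) * (P (e i)).comp (X + Polynomial.C ((j : ℕ) : ℤ))
  have hN : ∀ j i, (N j i).natDegree ≤ (P (e i)).natDegree := fun j i => by
    simp only [N, Matrix.of_apply]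
    refine (natDegree_C_mul_le _ ((P (e i)).comp (X + Polynomial.C ((j : ℕ) : ℤ)))).trans ?_
    rw [natDegree_comp, natDegree_X_add_C, mul_one]
  have hcoeff : ∀ j i, (N j i).coeff (P (e i)).natDegree =
      b ^ ((j : ℕ) * (e i : ℕ)) * (P (e i)).leadingCoeff := fun j i => by
    have h1 : ((P (e i)).comp (X + Polynomial.C ((j : ℕ) : ℤ))).natDegree =
        (P (e i)).natDegree := by rw [natDegree_comp, natDegree_X_add_C, mul_one]
    have h2 : ((P (e i)).comp (X + Polynomial.C ((j : ℕ) : ℤ))).leadingCoeff =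
        (P (e i)).leadingCoeff := by
      rw [leadingCoeff_comp (by rw [natDegree_X_add_C]; exact one_ne_zero),
        leadingCoeff_X_add_C, one_pow, mul_one]
    simp only [N, Matrix.of_apply, coeff_C_mul]
    rw [← h2, leadingCoeff, h1]
  have hdet : N.det ≠ 0 := by
    intro h0
    have h1 := coeff_det_sum_of_natDegree_le N _ hN
    rw [h0, coeff_zero] at h1
    have h2 : (Matrix.of fun j i => (N j i).coeff (P (e i)).natDegree) =
        Matrix.of fun j i => (P (e i)).leadingCoeff *
          (Matrix.vandermonde fun i : Fin r => b ^ (e i : ℕ)).transpose j i := by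
      ext j i
      simp only [Matrix.of_apply, hcoeff, Matrix.transpose_apply, Matrix.vandermonde_apply]
      rw [mul_comm, mul_comm (j : ℕ), pow_mul]
    rw [h2, Matrix.det_mul_row, Matrix.det_transpose] at h1
    rcases mul_eq_zero.1 h1.symm with h3 | h3
    · obtain ⟨i, _, hi⟩ := Finset.prod_eq_zero_iff.1 h3
      exact he i (leadingCoeff_eq_zero.1 hi)
    · refine Matrix.det_vandermonde_ne_zero_iff.2 ?_ h3
      intro i j hij
      have := Int.pow_right_injective (a := b) (by omega) hij
      exact e.injective (Fin.ext this)
  have hroot : ∀ z ∈ Z, N.det.eval z = 0 := by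
    intro z hz
    have h1 : N.det.eval z = (N.map (evalRingHom z)).det := by
      rw [← coe_evalRingHom, RingHom.map_det]; rfl
    rw [h1, ← Matrix.exists_mulVec_eq_zero_iff]
    refine ⟨fun i => w z (e i), fun h0 => hw z hz _ (congrFun h0 ⟨0, hr0⟩), ?_⟩
    funext j
    have h2 := h z hz j (by omega)
    have h3 : ∑ c ∈ s, (P c).eval (z + (j : ℕ)) * b ^ ((j : ℕ) * (c : ℕ)) * w z c = 0 := by
      rw [← h2]
      refine Finset.sum_subset (Finset.subset_univ _) fun c _ hc => ?_
      have : P c = 0 := by simpa [hs] using hc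
      simp [this]
    have h4 : s = Finset.univ.map e.toEmbedding := by
      have := s.image_orderEmbOfFin_univ rfl
      rw [Finset.map_eq_image]; exact this.symm
    rw [h4, Finset.sum_map] at h3
    simp only [Matrix.mulVec, dotProduct, Matrix.map_apply, Pi.zero_apply, N, Matrix.of_apply]
    rw [← h3]
    refine Finset.sum_congr rfl fun i _ => ?_
    simp only [coe_evalRingHom, eval_mul, eval_C, eval_comp, eval_add, eval_X]
    rw [mul_comm (b ^ _)]
    rfl
  by_contra! hcard
  refine hdet (eq_zero_of_natDegree_lt_card_of_eval_eq_zero' N.det Z hroot (lt_of_lt_of_le ?_ hcard))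
  calc N.det.natDegree ≤ ∑ i, (P (e i)).natDegree := natDegree_det_le_sum N _ hN
    _ < ∑ _i : Fin r, A := Finset.sum_lt_sum_of_nonempty ⟨⟨0, hr0⟩, Finset.mem_univ _⟩
        fun i _ => hP _
    _ = r * A := by simp
    _ ≤ A * C := by rw [mul_comm]; exact Nat.mul_le_mul_left _ hrC

theorem exists_ne_zero_forall_dvd_sum_mul {ι κ : Type*} [Fintype ι] [Fintype κ] (D H : ℕ)
    [NeZero D] (hDH : D ^ Fintype.card κ < H ^ Fintype.card ι) (f : κ → ι → ℤ) :
    ∃ p : ι → ℤ, p ≠ 0 ∧ (∀ i, |p i| < H) ∧ ∀ k, (D : ℤ) ∣ ∑ i, p i * f k i := by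
  classical
  let φ : (ι → Fin H) → κ → ZMod D := fun v k => ((∑ i, ((v i : ℕ) : ℤ) * f k i : ℤ) : ZMod D)
  obtain ⟨v, v', hne, hv⟩ := Fintype.exists_ne_map_eq_of_card_lt φ (by simpa using hDH)
  refine ⟨fun i => ((v i : ℕ) : ℤ) - (v' i : ℕ), fun h => hne ?_, fun i => ?_, fun k => ?_⟩
  · funext i
    have := congrFun h i
    simp only [Pi.zero_apply] at this
    exact Fin.ext (by omega)
  · have h1 := (v i).2
    have h2 := (v' i).2
    change |((v i : ℕ) : ℤ) - (v' i : ℕ)| < H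
    rw [abs_lt]
    omega
  · have h1 := congrFun hv k
    simp only [φ] at h1
    rw [ZMod.intCast_eq_intCast_iff_dvd_sub] at h1
    rw [← dvd_neg]
    have h2 : ∑ i, (((v i : ℕ) : ℤ) - (v' i : ℕ)) * f k i =
        ∑ i, ((v i : ℕ) : ℤ) * f k i - ∑ i, ((v' i : ℕ) : ℤ) * f k i := by
      rw [← Finset.sum_sub_distrib]
      exact Finset.sum_congr rfl fun i _ => sub_mul _ _ _
    change (D : ℤ) ∣ -∑ i, (((v i : ℕ) : ℤ) - (v' i : ℕ)) * f k i
    rwa [h2, neg_sub]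

theorem exists_polynomial_forall_dvd_sum_eval_mul {A C K : ℕ} (hA : 1 ≤ A) (D H : ℕ) [NeZero D]
    (hDH : D ^ K < H ^ (A * C)) (f : ℕ → Fin C → ℤ) :
    ∃ P : Fin C → ℤ[X], (∀ c, (P c).natDegree < A) ∧ (∃ c, P c ≠ 0) ∧
      (∀ c a, |(P c).coeff a| ≤ H) ∧
      ∀ z < K, (D : ℤ) ∣ ∑ c, (P c).eval (z : ℤ) * f z c := by
  classical
  obtain ⟨p, hp, hH, hd⟩ := exists_ne_zero_forall_dvd_sum_mul (ι := Fin C × Fin A) (κ := Fin K)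
    D H (by simpa [mul_comm] using hDH) (fun z i => (z : ℤ) ^ (i.2 : ℕ) * f z i.1)
  have hdeg : ∀ c, (ofFn A fun a => p (c, a)).natDegree < A := fun c => ofFn_natDegree_lt hA _
  refine ⟨fun c => ofFn A fun a => p (c, a), hdeg, ?_, fun c a => ?_, fun z hz => ?_⟩
  · by_contra! h
    refine hp (funext fun i => ?_)
    have := congrArg (fun q => q.coeff i.2) (h i.1)
    simpa [ofFn_coeff_eq_val_of_lt] using this
  · rcases lt_or_ge a A with ha | ha
    · rw [ofFn_coeff_eq_val_of_lt _ ha]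
      exact (hH _).le
    · rw [ofFn_coeff_eq_zero_of_ge _ ha]
      simp
  · have := hd ⟨z, hz⟩
    rw [Fintype.sum_prod_type] at this
    convert this using 2 with c
    rw [eval_eq_sum_range' (hdeg c), Finset.sum_mul, Finset.sum_range]
    refine Finset.sum_congr rfl fun a _ => ?_
    rw [ofFn_coeff_eq_val_of_lt _ a.2]
    simp only [mul_assoc, Fin.eta]

/-- `S` and `T` bound the range of the points, `Y` the size of `b`, `u` and `q`. -/
theorem false_of_pow_dvd_pow_mul_sub (g b u q : ℤ) (n M A C H S T Y : ℕ) (hA : 1 ≤ A)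
    (hg : 1 ≤ g) (hb : 2 ≤ b) (hbg : g ∣ b - 1) (hu : u ≠ 0) (hq : q ≠ 0)
    (hcong : g ^ M ∣ b ^ n * q - u) (hbY : |b| ≤ Y) (huY : |u| ≤ Y) (hqY : |q| ≤ Y)
    (hpig : g ^ (M * (A + M)) < (H : ℤ) ^ (A * C))
    (hsize : (C : ℤ) * (A * (H * ((n + 1) * S) ^ A * Y ^ (2 * C * S))) < g ^ M)
    (hSn : S ≤ n) (hTC : T + C ≤ S) (hcount : A * C ≤ T * S) : False := by
  classical
  obtain ⟨D, hD⟩ := Int.eq_ofNat_of_zero_le (show (0 : ℤ) ≤ g ^ M by positivity)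
  have hD0 : NeZero D := ⟨by rintro rfl; have : 0 < g ^ M := by positivity
                             simp [hD] at this⟩
  obtain ⟨P, hdeg, hne, hcoef, hdvd⟩ := exists_polynomial_forall_dvd_sum_eval_mul (A := A) (C := C)
    (K := A + M) hA D H (by rw [pow_mul, hD] at hpig; exact_mod_cast hpig)
    fun z c => b ^ ((c : ℕ) * z)
  rw [← hD] at hdvd
  have hF := pow_dvd_sum_eval_mul_pow g P hdeg b hbg hdvd
  have hY1 : (1 : ℤ) ≤ Y := le_trans (by rw [le_abs]; left; omega) hbY
  have hG : ∀ s < S, ∀ t < S, ∑ c : Fin C, (P c).eval ((s + n * t : ℕ) : ℤ) *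
      (b ^ ((c : ℕ) * s) * u ^ ((c : ℕ) * t) * q ^ ((C - 1 - (c : ℕ)) * t)) = 0 := by
    intro s hs t ht
    have hS1 : 1 ≤ S := by omega
    refine Int.eq_zero_of_abs_lt_dvd (m := g ^ M) ?_ (lt_of_le_of_lt ?_ hsize)
    · have h1 := Dvd.dvd.mul_left (hF (s + n * t)) (q ^ ((C - 1) * t))
      rw [← (dvd_sub_right h1 (a := g ^ M) )]
      rw [Finset.mul_sum, ← Finset.sum_sub_distrib]
      refine Finset.dvd_sum fun c _ => ?_
      have hc : C - 1 = (C - 1 - (c : ℕ)) + c := by omega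
      have h2 : q ^ ((C - 1) * t) * ((P c).eval ((s + n * t : ℕ) : ℤ) *
          b ^ ((c : ℕ) * (s + n * t))) - (P c).eval ((s + n * t : ℕ) : ℤ) *
          (b ^ ((c : ℕ) * s) * u ^ ((c : ℕ) * t) * q ^ ((C - 1 - (c : ℕ)) * t)) =
          (P c).eval ((s + n * t : ℕ) : ℤ) * b ^ ((c : ℕ) * s) * q ^ ((C - 1 - (c : ℕ)) * t) *
          ((b ^ n * q) ^ ((c : ℕ) * t) - u ^ ((c : ℕ) * t)) := by
        nth_rewrite 1 [hc]
        ring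
      rw [h2]
      exact Dvd.dvd.mul_left (hcong.trans (sub_dvd_pow_sub_pow _ _ _)) _
    · have hterm : ∀ c : Fin C, |(P c).eval ((s + n * t : ℕ) : ℤ) *
          (b ^ ((c : ℕ) * s) * u ^ ((c : ℕ) * t) * q ^ ((C - 1 - (c : ℕ)) * t))| ≤
          A * (H * ((n + 1) * S) ^ A) * Y ^ (2 * C * S) := by
        intro c
        rw [abs_mul]
        refine mul_le_mul ?_ ?_ (abs_nonneg _) (by positivity)
        · rw [eval_eq_sum_range' (hdeg c)]
          refine (Finset.abs_sum_le_sum_abs _ _).trans ?_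
          have : ∀ a ∈ Finset.range A, |(P c).coeff a * ((s + n * t : ℕ) : ℤ) ^ a| ≤
              (H : ℤ) * ((n + 1) * S) ^ A := by
            intro a ha
            rw [abs_mul]
            refine mul_le_mul (hcoef c a) ?_ (abs_nonneg _) (by positivity)
            rw [abs_of_nonneg (by positivity)]
            have h1 : s + n * t ≤ (n + 1) * S := by
              nlinarith [Nat.mul_le_mul_left n ht.le]
            have h2 : (1 : ℤ) ≤ (n + 1) * S := by
              have : (1 : ℤ) ≤ S := by exact_mod_cast hS1
              nlinarith
            calc ((s + n * t : ℕ) : ℤ) ^ a ≤ ((n + 1) * S) ^ a :=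
                  pow_le_pow_left₀ (by positivity) (by exact_mod_cast h1) _
              _ ≤ _ := pow_le_pow_right₀ h2 (Finset.mem_range.1 ha).le
          refine (Finset.sum_le_card_nsmul _ _ _ this).trans ?_
          simp
        · rw [abs_mul, abs_mul, abs_pow, abs_pow, abs_pow]
          calc |b| ^ ((c : ℕ) * s) * |u| ^ ((c : ℕ) * t) * |q| ^ ((C - 1 - (c : ℕ)) * t)
              ≤ Y ^ ((c : ℕ) * s) * Y ^ ((c : ℕ) * t) * Y ^ ((C - 1 - (c : ℕ)) * t) := by gcongr
            _ = (Y : ℤ) ^ ((c : ℕ) * s + (c : ℕ) * t + (C - 1 - (c : ℕ)) * t) := by ring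
            _ ≤ _ := by
              refine pow_le_pow_right₀ hY1 ?_
              have : (c : ℕ) * t + (C - 1 - (c : ℕ)) * t = (C - 1) * t := by
                rw [← add_mul]
                congr 1
                omega
              rw [add_assoc, this, two_mul, add_mul]
              exact Nat.add_le_add (Nat.mul_le_mul c.2.le hs.le)
                (Nat.mul_le_mul (by omega) ht.le)
      refine (Finset.abs_sum_le_sum_abs _ _).trans
        ((Finset.sum_le_card_nsmul _ _ _ fun c _ => hterm c).trans (le_of_eq ?_))
      rw [Finset.card_univ, Fintype.card_fin, nsmul_eq_mul]
      ring
  rcases Nat.eq_zero_or_pos T with rfl | hT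
  · obtain ⟨c, -⟩ := hne
    have : 1 ≤ C := c.pos
    have := Nat.mul_le_mul hA this
    omega
  have hn : 0 < n := by omega
  let Z : Finset ℤ := (Finset.range T ×ˢ Finset.range S).image fun i => ((i.1 + n * i.2 : ℕ) : ℤ)
  have hdec : ∀ s < T, ∀ t, (s + n * t) % n = s ∧ (s + n * t) / n = t := by
    intro s hs t
    have hsn : s < n := by omega
    exact ⟨by rw [Nat.add_mul_mod_self_left, Nat.mod_eq_of_lt hsn],
      by rw [Nat.add_mul_div_left _ _ hn, Nat.div_eq_of_lt hsn, zero_add]⟩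
  have hZ : Z.card = T * S := by
    rw [Finset.card_image_of_injOn, Finset.card_product, Finset.card_range, Finset.card_range]
    rintro ⟨s, t⟩ hi ⟨s', t'⟩ hj hij
    simp only [Finset.coe_product, Finset.coe_range, Set.mem_prod, Set.mem_Iio] at hi hj
    have hij' : s + n * t = s' + n * t' := by
      simpa only [Nat.cast_inj] using hij
    have h1 := hdec s hi.1 t
    have h2 := hdec s' hj.1 t'
    rw [hij'] at h1
    exact Prod.ext (h1.1.symm.trans h2.1) (h1.2.symm.trans h2.2)
  have := card_lt_of_sum_eval_mul_pow_eq_zero P hdeg hne b hb Z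
    (fun z c => b ^ ((c : ℕ) * (z.toNat % n)) * u ^ ((c : ℕ) * (z.toNat / n)) *
      q ^ ((C - 1 - (c : ℕ)) * (z.toNat / n)))
    (fun z _ c => by have : b ≠ 0 := by omega
                     positivity)
    (fun z hz j hj => by
      obtain ⟨⟨s, t⟩, hi, rfl⟩ := Finset.mem_image.1 hz
      simp only [Finset.mem_product, Finset.mem_range] at hi
      obtain ⟨h1, h2⟩ := hdec s hi.1 t
      rw [← hG (s + j) (by omega) t hi.2]
      refine Finset.sum_congr rfl fun c _ => ?_
      rw [Int.toNat_natCast, h1, h2]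
      have : ((s + n * t : ℕ) : ℤ) + j = ((s + j + n * t : ℕ) : ℤ) := by push_cast; ring
      rw [this]
      ring)
  omega

end

theorem IsNSol.mul_sub_one {N x m : ℕ} (h : IsNSol N x m) : (N : ℤ) * (x - 1) = x ^ m - 1 := by
  rw [← h.2.2]
  push_cast
  exact geom_sum_mul _ _

theorem IsNSol.pow_pred_lt {N x m : ℕ} (h : IsNSol N x m) : x ^ (m - 1) < N := by
  obtain ⟨hx, hm, h⟩ := h
  obtain ⟨k, rfl⟩ := Nat.exists_eq_add_of_le' hm
  rw [← h, Finset.sum_range_succ, Finset.sum_range_succ']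
  simp

theorem IsNSol.lt_pow {N x m : ℕ} (h : IsNSol N x m) : N < x ^ m := by
  have h1 := h.mul_sub_one
  have h2 : (2 : ℤ) ≤ x := by exact_mod_cast h.1
  have : (N : ℤ) < x ^ m := by nlinarith
  exact_mod_cast this

theorem IsNSol.exponent_lt {N x y m n : ℕ} (hx : IsNSol N x m) (hy : IsNSol N y n) (hxy : x < y) :
    n < m := by
  by_contra! hmn
  have h1 : ∑ i ∈ Finset.range m, x ^ i < ∑ i ∈ Finset.range m, y ^ i := by
    refine Finset.sum_lt_sum (fun i _ => Nat.pow_le_pow_left hxy.le i)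
      ⟨1, Finset.mem_range.2 (by have := hx.2.1; omega), by simpa using hxy⟩
  have h2 : ∑ i ∈ Finset.range m, y ^ i ≤ ∑ i ∈ Finset.range n, y ^ i :=
    Finset.sum_le_sum_of_subset (Finset.range_subset_range.2 hmn)
  rw [hx.2.2] at h1
  rw [hy.2.2] at h2
  omega

theorem IsNSol.pow_lt_of_not_coprime {N x y m n : ℕ} (hx : IsNSol N x m) (hy : IsNSol N y n)
    (hxy : x < y) (hc : ¬ x.Coprime y) : 2 ^ n < y := by
  obtain ⟨p, hp, hpx, hpy⟩ := Nat.Prime.not_coprime_iff_dvd.1 hc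
  have h1 := hx.mul_sub_one
  have h2 := hy.mul_sub_one
  have hpx' : (p : ℤ) ∣ x := by exact_mod_cast hpx
  have hpy' : (p : ℤ) ∣ y := by exact_mod_cast hpy
  have h3 : (p : ℤ) ^ n ∣ N * (y - x) := by
    have : (N : ℤ) * (y - x) = y ^ n - x ^ m := by linear_combination h2 - h1
    rw [this]
    exact dvd_sub (pow_dvd_pow_of_dvd hpy' n)
      ((pow_dvd_pow _ (hx.exponent_lt hy hxy).le).trans (pow_dvd_pow_of_dvd hpx' m))
  have h4 : IsCoprime (p : ℤ) N := by
    obtain ⟨k, hk⟩ := hpx'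
    obtain ⟨l, rfl⟩ := Nat.exists_eq_add_of_le' hx.2.1
    refine ⟨-(N - x ^ (l + 1)) * k, 1, ?_⟩
    linear_combination (N - (x : ℤ) ^ (l + 1)) * hk - h1
  have h5 : (p : ℤ) ^ n ∣ y - x := (h4.pow_left).dvd_of_dvd_mul_left h3
  have h6 : (p : ℤ) ^ n ≤ y - x := Int.le_of_dvd (by omega) h5
  have h7 : (2 : ℤ) ^ n ≤ p ^ n := by
    have := hp.two_le
    gcongr
    exact_mod_cast this
  have h8 : (2 : ℤ) ≤ x := by exact_mod_cast hx.1
  have : (2 : ℤ) ^ n < y := by linarith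
  exact_mod_cast this

theorem pow_six_le_two_pow {l : ℕ} (hl : 45 ≤ l) : (l + 1) ^ 6 ≤ 2 ^ l := by
  induction l, hl using Nat.le_induction with
  | base => norm_num
  | succ l hl ih =>
    rw [pow_succ 2]
    have : (l + 1 + 1) ^ 6 ≤ (l + 1) ^ 6 * 2 := by
      obtain ⟨t, rfl⟩ := Nat.exists_eq_add_of_le hl
      zify
      ring_nf
      nlinarith [(by positivity : (0 : ℤ) ≤ t), sq_nonneg (t : ℤ),
        (by positivity : (0 : ℤ) ≤ (t : ℤ) ^ 3), (by positivity : (0 : ℤ) ≤ (t : ℤ) ^ 4),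
        (by positivity : (0 : ℤ) ≤ (t : ℤ) ^ 5), (by positivity : (0 : ℤ) ≤ (t : ℤ) ^ 6)]
    omega

theorem mul_log_sq_mul_pow_four_le {m y : ℕ} (hy : 1 ≤ y) (h : 2 ^ 45 * y ^ 6 < m) :
    33280 * (8 * (Nat.log 2 m + 1) + 4) ^ 2 * y ^ 4 ≤ m := by
  have hm0 : m ≠ 0 := by omega
  have h1 : 2 ^ 45 ≤ m := by
    have : 1 ≤ y ^ 6 := Nat.one_le_pow _ _ hy
    omega
  have hl : 45 ≤ Nat.log 2 m := (Nat.le_log_iff_pow_le (by norm_num) hm0).2 h1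
  have h2 : (Nat.log 2 m + 1) ^ 6 ≤ m :=
    (pow_six_le_two_pow hl).trans (Nat.pow_log_le_self 2 hm0)
  set l := Nat.log 2 m + 1
  refine le_of_pow_le_pow_left₀ (n := 3) (by norm_num) (by positivity) ?_
  calc (33280 * (8 * l + 4) ^ 2 * y ^ 4) ^ 3 ≤ (33280 * (12 * l) ^ 2 * y ^ 4) ^ 3 := by
        gcongr
        omega
    _ = 33280 ^ 3 * 12 ^ 6 * (l ^ 6 * (y ^ 6) ^ 2) := by ring
    _ ≤ (2 ^ 45) ^ 2 * (l ^ 6 * (y ^ 6) ^ 2) := by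
        gcongr
        norm_num
    _ = l ^ 6 * (2 ^ 45 * y ^ 6) ^ 2 := by ring
    _ ≤ m * m ^ 2 := by gcongr
    _ = m ^ 3 := by ring

theorem mul_pow_mul_pow_lt {x y m n e l κ S A : ℕ} (hx : 2 ≤ x) (hy1 : 1 ≤ y) (hyx : y ≤ x ^ y)
    (hey : e ≤ y) (hnm : n < m) (hSn : S ≤ n) (hlg : m < 2 ^ l) (hκ : κ = 8 * l + 4)
    (hS : S = 520 * y ^ 2 * κ) (hA : A = 32 * y ^ 2 * S) :
    (8 * κ) * (2 * A * (x ^ (κ * A) * ((n + 1) * S) ^ (2 * A) *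
      (y ^ e) ^ (2 * (8 * κ) * S))) < x ^ (2 * κ * A) := by
  have hSpos : 1 ≤ S := by rw [hS, hκ]; exact Nat.one_le_iff_ne_zero.2 (by positivity)
  have hApos : 1 ≤ A := by rw [hA]; exact Nat.one_le_iff_ne_zero.2 (by positivity)
  have hnS : (n + 1) * S ≤ 2 ^ (2 * l) := by
    rw [two_mul, pow_add]
    exact Nat.mul_le_mul (by omega) (by omega)
  have h1 : 16 * κ * A < 2 ^ (2 * A) := by
    have h2 : 16 * κ ≤ A := by
      rw [hA, hS]
      have : 1 ≤ y ^ 4 := Nat.one_le_pow _ _ hy1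
      nlinarith
    have h3 : A < 2 ^ A := Nat.lt_two_pow_self
    calc 16 * κ * A ≤ A * A := Nat.mul_le_mul_right _ h2
      _ < 2 ^ A * 2 ^ A := Nat.mul_lt_mul'' h3 h3
      _ = _ := by rw [two_mul, pow_add]
  have hhalf : κ * A = (4 * l + 2) * A + 16 * κ * S * y * y := by
    have : 16 * κ * S * y * y = (4 * l + 2) * A := by rw [hA, hκ]; ring
    rw [this, hκ]; ring
  calc (8 * κ) * (2 * A * (x ^ (κ * A) * ((n + 1) * S) ^ (2 * A) *
          (y ^ e) ^ (2 * (8 * κ) * S)))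
        ≤ (8 * κ) * (2 * A * (x ^ (κ * A) * (2 ^ (2 * l)) ^ (2 * A) *
          ((x ^ y) ^ y) ^ (2 * (8 * κ) * S))) := by
          gcongr
          exact Nat.one_le_pow _ _ (by omega)
      _ = x ^ (κ * A) * (((16 * κ * A) * 2 ^ (4 * l * A)) * x ^ (16 * κ * S * y * y)) := by
          ring
      _ < x ^ (κ * A) * ((2 ^ (2 * A) * 2 ^ (4 * l * A)) * x ^ (16 * κ * S * y * y)) := by
          gcongr
      _ = x ^ (κ * A) * (2 ^ ((4 * l + 2) * A) * x ^ (16 * κ * S * y * y)) := by ring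
      _ ≤ x ^ (κ * A) * (x ^ ((4 * l + 2) * A) * x ^ (16 * κ * S * y * y)) := by gcongr
      _ = x ^ (κ * A) * x ^ (κ * A) := by rw [← pow_add x ((4 * l + 2) * A), ← hhalf]
      _ = x ^ (2 * κ * A) := by rw [← pow_add]; congr 1; ring

theorem IsNSol.exponent_le {N x y m n : ℕ} (hx : IsNSol N x m) (hy : IsNSol N y n)
    (hxy : x < y) (hc : x.Coprime y) : m ≤ 2 ^ 45 * y ^ 6 := by
  by_contra! hm
  have hx2 := hx.1
  have hnm := hx.exponent_lt hy hxy
  have hM := mul_log_sq_mul_pow_four_le (by omega) hm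
  have hlg : m < 2 ^ (Nat.log 2 m + 1) := Nat.lt_pow_succ_log_self (by norm_num) m
  generalize Nat.log 2 m + 1 = l at hM hlg
  obtain ⟨κ, hκ⟩ : ∃ κ, κ = 8 * l + 4 := ⟨_, rfl⟩
  rw [← hκ] at hM
  obtain ⟨S, hS⟩ : ∃ S, S = 520 * y ^ 2 * κ := ⟨_, rfl⟩
  obtain ⟨A, hA⟩ : ∃ A, A = 32 * y ^ 2 * S := ⟨_, rfl⟩
  have hMA : 33280 * κ ^ 2 * y ^ 4 = 2 * κ * A := by rw [hA, hS]; ring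
  rw [hMA] at hM
  have hy1 : 1 ≤ y := by omega
  have hκ1 : 4 ≤ κ := by omega
  have hSpos : 1 ≤ S := by rw [hS]; exact Nat.one_le_iff_ne_zero.2 (by positivity)
  have hApos : 1 ≤ A := by rw [hA]; exact Nat.one_le_iff_ne_zero.2 (by positivity)
  have hyx : y ≤ x ^ y := (Nat.lt_pow_self (by omega)).le
  have hSn : S ≤ n := by
    have h1 : x ^ (m - 1) < x ^ (y * n) :=
      calc x ^ (m - 1) < N := hx.pow_pred_lt
        _ < y ^ n := hy.lt_pow
        _ ≤ (x ^ y) ^ n := Nat.pow_le_pow_left hyx n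
        _ = _ := (pow_mul _ _ _).symm
    have h2 : m - 1 < y * n := (Nat.pow_lt_pow_iff_right (by omega)).1 h1
    have h3 : y * S + 1 ≤ 2 * κ * A := by
      have : 2 * κ * A = (64 * κ * y) * (y * S) := by rw [hA]; ring
      rw [this]
      have h4 : 1 ≤ y * S := Nat.mul_pos hy1 hSpos
      have h5 : 2 ≤ 64 * κ * y := by nlinarith
      nlinarith
    have h6 : y * S < y * n := by omega
    exact (Nat.lt_of_mul_lt_mul_left h6).le
  obtain ⟨e, he⟩ : ∃ e, e = Nat.totient x := ⟨_, rfl⟩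
  have he1 : 1 ≤ e := he ▸ Nat.totient_pos.2 (by omega)
  have hey : e ≤ y := he ▸ (Nat.totient_le x).trans hxy.le
  have hxy' : (x : ℤ) < y := by exact_mod_cast hxy
  have hx2' : (2 : ℤ) ≤ x := by exact_mod_cast hx2
  have hid : ((x : ℤ) - 1) * y ^ n - (x - y) = (y - 1) * x ^ m := by
    linear_combination ((y : ℤ) - 1) * hx.mul_sub_one - ((x : ℤ) - 1) * hy.mul_sub_one
  refine false_of_pow_dvd_pow_mul_sub x (y ^ e) ((x - y) ^ e) ((x - 1) ^ e) n (2 * κ * A) (2 * A)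
    (8 * κ) (x ^ (κ * A)) S (512 * y ^ 2 * κ) (y ^ e) (by omega) (by omega) ?_ ?_ ?_ ?_ ?_ ?_ ?_ ?_
    ?_ ?_ hSn ?_ ?_
  · calc (2 : ℤ) ≤ y ^ 1 := by rw [pow_one]; omega
      _ ≤ y ^ e := pow_le_pow_right₀ (by omega) he1
  · have h1 := (Nat.ModEq.pow_totient hc.symm).symm
    rw [← he] at h1
    have h2 := (Nat.modEq_iff_dvd.1 h1)
    simpa using h2
  · exact pow_ne_zero _ (by omega)
  · exact pow_ne_zero _ (by omega)
  · refine (pow_dvd_pow (x : ℤ) hM).trans ?_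
    have h1 : ((y : ℤ) ^ e) ^ n * (x - 1) ^ e = (((x : ℤ) - 1) * y ^ n) ^ e := by
      rw [mul_pow, ← pow_mul, ← pow_mul, mul_comm e n, mul_comm]
    rw [h1]
    exact (Dvd.intro_left _ hid.symm).trans (sub_dvd_pow_sub_pow _ _ _)
  · push_cast
    rw [abs_of_nonneg (by positivity)]
  · push_cast
    rw [abs_pow]
    exact pow_le_pow_left₀ (abs_nonneg _) (abs_le.2 ⟨by omega, by omega⟩) _
  · push_cast
    rw [abs_pow]
    exact pow_le_pow_left₀ (abs_nonneg _) (abs_le.2 ⟨by omega, by omega⟩) _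
  · push_cast
    rw [← pow_mul]
    refine pow_lt_pow_right₀ (by omega) ?_
    have h1 : 0 < κ * A * A := by positivity
    have h2 : 4 * (κ * A * A) ≤ κ * (κ * A * A) := Nat.mul_le_mul_right _ hκ1
    nlinarith
  · exact_mod_cast mul_pow_mul_pow_lt hx2 hy1 hyx hey (by omega) hSn hlg hκ hS hA
  · have : κ * 1 ≤ κ * y ^ 2 := Nat.mul_le_mul_left _ (Nat.one_le_pow _ _ hy1)
    rw [hS]
    nlinarith
  · rw [hA]
    apply le_of_eq
    ring

theorem IsNSol.log_two_lt {N x y m n : ℕ} (hx : IsNSol N x m) (hy : IsNSol N y n) (hxy : x < y) :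
    Nat.log 2 N < y ^ 36 := by
  have hy3 : 3 ≤ y := by have := hx.1; omega
  have hN : N ≠ 0 := by have := hx.pow_pred_lt; omega
  refine Nat.log_lt_of_lt_pow hN ?_
  by_cases hc : x.Coprime y
  · have hm := hx.exponent_le hy hxy hc
    have h1 : x * m ≤ y ^ 36 :=
      calc x * m ≤ y * (2 ^ 45 * y ^ 6) := Nat.mul_le_mul hxy.le hm
        _ ≤ y * (3 ^ 29 * y ^ 6) := 
          Nat.mul_le_mul_left _ (Nat.mul_le_mul_right _ (by norm_num))
        _ ≤ y * (y ^ 29 * y ^ 6) := by gcongr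
        _ = y ^ 36 := by ring
    calc N < x ^ m := hx.lt_pow
      _ ≤ (2 ^ x) ^ m := Nat.pow_le_pow_left Nat.lt_two_pow_self.le m
      _ = 2 ^ (x * m) := (pow_mul _ _ _).symm
      _ ≤ _ := Nat.pow_le_pow_right (by norm_num) h1
  · have hn : n < y := Nat.lt_two_pow_self.trans (hx.pow_lt_of_not_coprime hy hxy hc)
    have h1 : y * n ≤ y ^ 36 :=
      calc y * n ≤ y * y := Nat.mul_le_mul_left _ hn.le
        _ = y ^ 2 := (sq y).symm
        _ ≤ _ := Nat.pow_le_pow_right (by omega) (by norm_num)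
    calc N < y ^ n := hy.lt_pow
      _ ≤ (2 ^ y) ^ n := Nat.pow_le_pow_left Nat.lt_two_pow_self.le n
      _ = 2 ^ (y * n) := (pow_mul _ _ _).symm
      _ ≤ _ := Nat.pow_le_pow_right (by norm_num) h1

theorem prod_primesLE_pow_dvd_factorial (n : ℕ) : ∏ p ∈ n.primesLE, p ^ (n / p) ∣ n.factorial := by
  refine Finset.prod_dvd_of_isRelPrime (fun p hp q hq hpq => ?_) fun p hp => ?_
  · exact Nat.coprime_iff_isRelPrime.1 (Nat.coprime_pow_primes _ _ (Nat.prime_of_mem_primesLE hp)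
      (Nat.prime_of_mem_primesLE hq) hpq)
  · rw [(Nat.prime_of_mem_primesLE hp).pow_dvd_factorial_iff (b := Nat.log p n + 2) (by omega)]
    simpa using Finset.single_le_sum (f := fun i => n / p ^ i) (fun i _ => Nat.zero_le _)
      (Finset.mem_Ico.2 ⟨le_refl 1, by omega⟩ : (1 : ℕ) ∈ Finset.Ico 1 (Nat.log p n + 2))

theorem Real.log_factorial_le {n : ℕ} (hn : 1 ≤ n) :
    Real.log n.factorial ≤ n * Real.log n - n + 1 + Real.log n := by
  induction n, hn using Nat.le_induction with
  | base => simp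
  | succ n hn ih =>
    have hn' : (0 : ℝ) < n := by exact_mod_cast hn
    have h1 : 1 - ((n + 1 : ℝ) / n)⁻¹ ≤ Real.log ((n + 1) / n) :=
      Real.one_sub_inv_le_log_of_pos (by positivity)
    rw [Real.log_div (by positivity) (by positivity), inv_div] at h1
    have h2 : (1 : ℝ) ≤ (n + 1) * (Real.log (n + 1) - Real.log n) := by
      calc (1 : ℝ) = (n + 1) * (1 - n / (n + 1)) := by field_simp; ring
        _ ≤ _ := by gcongr
    rw [Nat.factorial_succ, Nat.cast_mul, Real.log_mul (by positivity) (by positivity)]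
    push_cast
    nlinarith

theorem log_three_le : Real.log 3 ≤ 8 / 5 * Real.log 2 := by
  have h : Real.log (3 ^ 5) ≤ Real.log (2 ^ 8) := Real.log_le_log (by norm_num) (by norm_num)
  rw [Real.log_pow, Real.log_pow] at h
  norm_num at h
  linarith

theorem le_log_three : 1.0974 ≤ Real.log 3 := by
  have h : Real.log (2 ^ 19) ≤ Real.log (3 ^ 12) := Real.log_le_log (by norm_num) (by norm_num)
  rw [Real.log_pow, Real.log_pow] at h
  norm_num at h ⊢
  have := Real.log_two_gt_d9
  linarith

theorem sum_primesLE_log_div_le_of_sixteen_le {n : ℕ} (hn : 16 ≤ n) :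
    ∑ p ∈ n.primesLE, Real.log p / p ≤ Real.log n + 0.65 := by
  have hn' : (16 : ℝ) ≤ n := by exact_mod_cast hn
  have h1 : ∑ p ∈ n.primesLE, (n / p : ℕ) * Real.log p ≤ Real.log n.factorial := by
    have := Real.log_le_log (by
      exact_mod_cast Finset.prod_pos fun p hp =>
        Nat.pow_pos (Nat.prime_of_mem_primesLE hp).pos)
      (Nat.cast_le (α := ℝ).2 (Nat.le_of_dvd n.factorial_pos (prod_primesLE_pow_dvd_factorial n)))
    rw [Nat.cast_prod, Real.log_prod fun p hp => by
      have := (Nat.prime_of_mem_primesLE hp).pos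
      positivity] at this
    simpa [Real.log_pow] using this
  have h2 : n * ∑ p ∈ n.primesLE, Real.log p / p ≤
      ∑ p ∈ n.primesLE, (n / p : ℕ) * Real.log p + ∑ p ∈ n.primesLE, Real.log p := by
    rw [Finset.mul_sum, ← Finset.sum_add_distrib]
    refine Finset.sum_le_sum fun p hp => ?_
    have hp0 : (0 : ℝ) < p := by exact_mod_cast (Nat.prime_of_mem_primesLE hp).pos
    have h3 : (n : ℝ) / p ≤ (n / p : ℕ) + 1 := by
      rw [← Nat.floor_div_eq_div (K := ℝ)]
      exact (Nat.lt_floor_add_one _).le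
    have h4 : 0 ≤ Real.log p := Real.log_natCast_nonneg p
    calc n * (Real.log p / p) = n / p * Real.log p := by ring
      _ ≤ ((n / p : ℕ) + 1) * Real.log p := by gcongr
      _ = _ := by ring
  rw [← Chebyshev.theta_eq_sum_primesLE_log] at h2
  have h3 := Chebyshev.theta_le_log4_mul_x (x := n) (by positivity)
  have h4 := Real.log_factorial_le (n := n) (by omega)
  have h5 : Real.log 4 = 2 * Real.log 2 := by
    rw [show (4 : ℝ) = 2 ^ 2 by norm_num, Real.log_pow]; norm_num
  have h6 : Real.log n ≤ 4 * Real.log 2 + n / 16 - 1 := by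
    have h7 := Real.log_le_sub_one_of_pos (x := n / 16) (by positivity)
    rw [Real.log_div (by positivity) (by norm_num), show (16 : ℝ) = 2 ^ 4 by norm_num,
      Real.log_pow] at h7
    norm_num at h7
    linarith
  have h8 := Real.log_two_lt_d9
  rw [h5] at h3
  refine le_of_mul_le_mul_left ?_ (show (0 : ℝ) < n by positivity)
  nlinarith

theorem sum_primesLE_log_div_le {n : ℕ} (hn : 3 ≤ n) :
    ∑ p ∈ n.primesLE, Real.log p / p ≤ Real.log n + 0.65 := by
  rcases le_or_gt 16 n with h | h
  · exact sum_primesLE_log_div_le_of_sixteen_le h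
  have h1 : ∑ p ∈ n.primesLE, Real.log p / p ≤ ∑ p ∈ Nat.primesLE 15, Real.log p / p := by
    refine Finset.sum_le_sum_of_subset_of_nonneg (Nat.primesLE_mono (by omega)) fun p _ _ => ?_
    exact div_nonneg (Real.log_natCast_nonneg p) (Nat.cast_nonneg p)
  have h2 : Nat.primesLE 15 = {2, 3, 5, 7, 11, 13} := by decide
  have h3 : Real.log 3 ≤ Real.log n := Real.log_le_log (by norm_num) (by exact_mod_cast hn)
  have h5 : Real.log (5 ^ 3) ≤ Real.log (2 ^ 7) := Real.log_le_log (by norm_num) (by norm_num)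
  have h7 : Real.log (7 ^ 6) ≤ Real.log (2 ^ 17) := Real.log_le_log (by norm_num) (by norm_num)
  have h11 : Real.log (11 ^ 2) ≤ Real.log (2 ^ 7) := Real.log_le_log (by norm_num) (by norm_num)
  have h13 : Real.log (13 ^ 4) ≤ Real.log (2 ^ 15) := Real.log_le_log (by norm_num) (by norm_num)
  rw [Real.log_pow, Real.log_pow] at h5 h7 h11 h13
  push_cast at h5 h7 h11 h13
  have h4 := le_log_three
  have h6 := log_three_le
  have h8 := Real.log_two_lt_d9
  rw [h2] at h1
  norm_num at h1 h4 ⊢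
  linarith

theorem sum_primes_Icc_inv_le {y Y : ℕ} (hy : 3 ≤ y) (hY : y ≤ Y) :
    ∑ p ∈ (Finset.Icc y Y).filter Nat.Prime, (1 : ℝ) / p ≤
      1 + (Real.log (Real.log Y) - Real.log (Real.log y)) + 0.65 / Real.log y := by
  have hpos : ∀ {Y : ℕ}, y ≤ Y → 0 < Real.log Y := fun h =>
    Real.log_pos (by exact_mod_cast (by omega : 1 < _))
  have hG : ∀ {Y : ℕ}, y ≤ Y →
      ∑ p ∈ (Finset.Icc y Y).filter Nat.Prime, Real.log p / p ≤ Real.log Y + 0.65 := by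
    intro Y hY
    refine le_trans (Finset.sum_le_sum_of_subset_of_nonneg (fun p hp => ?_) fun p _ _ => ?_)
      (sum_primesLE_log_div_le (by omega))
    · simp only [Finset.mem_filter, Finset.mem_Icc] at hp
      exact Nat.mem_primesLE.2 ⟨hp.1.2, hp.2⟩
    · exact div_nonneg (Real.log_natCast_nonneg p) (Nat.cast_nonneg p)
  have key : ∑ p ∈ (Finset.Icc y Y).filter Nat.Prime, (1 : ℝ) / p -
      (∑ p ∈ (Finset.Icc y Y).filter Nat.Prime, Real.log p / p) / Real.log Y ≤
      Real.log (Real.log Y) - Real.log (Real.log y) + 0.65 / Real.log y - 0.65 / Real.log Y := by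
    induction Y, hY using Nat.le_induction with
    | base =>
      have := (hpos (le_refl y)).ne'
      rw [Finset.Icc_self, Finset.filter_singleton]
      split_ifs
      · rw [Finset.sum_singleton, Finset.sum_singleton]
        apply le_of_eq
        field_simp
        ring
      · simp
    | succ Y hY ih =>
      have ha := hpos hY
      have hb := hpos (hY.trans (Nat.le_succ Y))
      have hab : Real.log Y ≤ Real.log (Y + 1 : ℕ) :=
        Real.log_le_log (by exact_mod_cast (by omega : 0 < Y)) (by exact_mod_cast Nat.le_succ Y)
      have hstep : ∑ p ∈ (Finset.Icc y (Y + 1)).filter Nat.Prime, (1 : ℝ) / p -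
          (∑ p ∈ (Finset.Icc y (Y + 1)).filter Nat.Prime, Real.log p / p) / Real.log (Y + 1 : ℕ) =
          ∑ p ∈ (Finset.Icc y Y).filter Nat.Prime, (1 : ℝ) / p -
          (∑ p ∈ (Finset.Icc y Y).filter Nat.Prime, Real.log p / p) / Real.log (Y + 1 : ℕ) := by
        rw [← Finset.insert_Icc_right_eq_Icc_add_one (hY.trans (Nat.le_succ Y)),
          Finset.filter_insert]
        split_ifs
        · rw [Finset.sum_insert (by simp), Finset.sum_insert (by simp), add_div]
          have : Real.log (Y + 1 : ℕ) / (Y + 1 : ℕ) / Real.log (Y + 1 : ℕ) =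
              1 / (Y + 1 : ℕ) := by
            rw [div_right_comm, div_self hb.ne']
          rw [this]
          ring
        · rfl
      rw [hstep]
      have hlog := Real.one_sub_inv_le_log_of_pos (div_pos hb ha)
      rw [Real.log_div hb.ne' ha.ne', inv_div] at hlog
      set a := Real.log Y
      set b := Real.log (Y + 1 : ℕ)
      set G := ∑ p ∈ (Finset.Icc y Y).filter Nat.Prime, Real.log p / p
      have h1 : G * (1 / a - 1 / b) ≤ (a + 0.65) * (1 / a - 1 / b) :=
        mul_le_mul_of_nonneg_right (hG hY) (sub_nonneg.2 (one_div_le_one_div_of_le ha hab))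
      have h2 : (a + 0.65) * (1 / a - 1 / b) = 1 - a / b + (0.65 / a - 0.65 / b) := by
        field_simp
      have h3 : G * (1 / a - 1 / b) = G / a - G / b := by ring
      linarith
  have h1 := div_le_div_of_nonneg_right (hG hY) (hpos hY).le
  rw [add_div, div_self (hpos hY).ne'] at h1
  linarith

theorem sum_primes_Icc_inv_le_of_le_pow {y Y : ℕ} (hy : 3 ≤ y) (hY : Y ≤ y ^ 36) :
    ∑ p ∈ (Finset.Icc y Y).filter Nat.Prime, (1 : ℝ) / p ≤ 5.1967 := by
  rcases lt_or_ge Y y with h | h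
  · rw [Finset.Icc_eq_empty (by omega)]
    norm_num
  have h1 := sum_primes_Icc_inv_le hy h
  have hy3 : Real.log 3 ≤ Real.log y := Real.log_le_log (by norm_num) (by exact_mod_cast hy)
  have hl3 := le_log_three
  have hl3' := log_three_le
  have hl2 := Real.log_two_lt_d9
  have hY0 : (0 : ℝ) < Y := by exact_mod_cast (by omega : 0 < Y)
  have hlY : 0 < Real.log Y := Real.log_pos (by exact_mod_cast (by omega : 1 < Y))
  have hly : 0 < Real.log y := by linarith
  have h2 : Real.log Y ≤ 36 * Real.log y := by
    have : Real.log Y ≤ Real.log ((y : ℝ) ^ 36) := Real.log_le_log hY0 (by exact_mod_cast hY)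
    rw [Real.log_pow] at this
    exact_mod_cast this
  have h3 : Real.log (Real.log Y) ≤ Real.log 36 + Real.log (Real.log y) := by
    rw [← Real.log_mul (by norm_num) hly.ne']
    exact Real.log_le_log hlY h2
  have h4 : Real.log 36 = 2 * Real.log 2 + 2 * Real.log 3 := by
    rw [show (36 : ℝ) = 2 ^ 2 * 3 ^ 2 by norm_num, Real.log_mul (by norm_num) (by norm_num),
      Real.log_pow, Real.log_pow]
    norm_num
  have h5 : 0.65 / Real.log y ≤ 0.65 / 1.0974 :=
    div_le_div_of_nonneg_left (by norm_num) (by norm_num) (by linarith)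
  norm_num at h1 h5 hl3 ⊢
  linarith

theorem two_mul_card_primesBelow_le {y : ℕ} (hy : 2 ≤ y) : 2 * y.primesBelow.card ≤ y := by
  have h : y.primesBelow.card ≤ (Finset.range (y / 2)).card := by
    refine Finset.card_le_card_of_injOn (fun p => if p = 2 then 0 else p / 2)
      (fun p hp => ?_) fun p hp q hq hpq => ?_
    · have h1 := Nat.lt_of_mem_primesBelow hp
      have h2 := (Nat.prime_of_mem_primesBelow hp).eq_two_or_odd
      simp only [Finset.coe_range, Set.mem_Iio]
      split_ifs <;> omega
    · have h1 := (Nat.prime_of_mem_primesBelow hp).eq_two_or_odd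
      have h2 := (Nat.prime_of_mem_primesBelow hq).eq_two_or_odd
      have h3 := (Nat.prime_of_mem_primesBelow hp).two_le
      have h4 := (Nat.prime_of_mem_primesBelow hq).two_le
      simp only at hpq
      split_ifs at hpq <;> omega
  rw [Finset.card_range] at h
  omega

theorem mul_succ_lt_two_pow {l : ℕ} (hl : 6 ≤ l) : (l + 1) * l < 2 ^ l := by
  induction l, hl using Nat.le_induction with
  | base => norm_num
  | succ l hl ih =>
    rw [pow_succ 2]
    nlinarith

theorem sum_one_div_le_of_lt {N k : ℕ} (s : Finset ℕ) (hs : ∀ z ∈ s, ∃ n, IsNSol N z n)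
    (hk : ∀ z ∈ s, 2 ^ k ≤ z) (hL : ∀ z ∈ s, Nat.log 2 N < z) :
    k * ∑ z ∈ s, (1 : ℝ) / z ≤ 1 := by
  rcases Nat.eq_zero_or_pos k with rfl | hk0
  · simp
  choose! e he using hs
  set L := Nat.log 2 N
  have hcard : s.card ≤ (Finset.Icc 1 (L / k)).card := by
    refine Finset.card_le_card_of_injOn (fun z => e z - 1) (fun z hz => ?_) fun z hz w hw hzw => ?_
    · have h1 := (he z hz).2.1
      have h2 : 2 ^ (k * (e z - 1)) ≤ N :=
        calc 2 ^ (k * (e z - 1)) = (2 ^ k) ^ (e z - 1) := pow_mul _ _ _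
          _ ≤ z ^ (e z - 1) := Nat.pow_le_pow_left (hk z hz) _
          _ ≤ N := (he z hz).pow_pred_lt.le
      have h3 : k * (e z - 1) ≤ L := Nat.le_log_of_pow_le (by norm_num) h2
      simp only [Finset.coe_Icc, Set.mem_Icc]
      refine ⟨by omega, (Nat.le_div_iff_mul_le hk0).2 ?_⟩
      rwa [mul_comm]
    · have h1 := (he z hz).2.1
      have h2 := (he w hw).2.1
      simp only at hzw
      rcases lt_trichotomy z w with h | h | h
      · have := (he z hz).exponent_lt (he w hw) h
        omega
      · exact h
      · have := (he w hw).exponent_lt (he z hz) h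
        omega
  rw [Nat.card_Icc, Nat.add_sub_cancel] at hcard
  have h1 : k * s.card ≤ L + 1 :=
    ((Nat.mul_le_mul_left k hcard).trans (Nat.mul_div_le L k)).trans (Nat.le_succ L)
  have h2 : ∑ z ∈ s, (1 : ℝ) / z ≤ s.card • (1 / ((L + 1 : ℕ) : ℝ)) := by
    refine Finset.sum_le_card_nsmul _ _ _ fun z hz => ?_
    exact one_div_le_one_div_of_le (by positivity) (by exact_mod_cast hL z hz)
  have h3 : ((k * s.card : ℕ) : ℝ) ≤ ((L + 1 : ℕ) : ℝ) := by exact_mod_cast h1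
  calc k * ∑ z ∈ s, (1 : ℝ) / z ≤ k * (s.card • (1 / ((L + 1 : ℕ) : ℝ))) := by gcongr
    _ = ((k * s.card : ℕ) : ℝ) / ((L + 1 : ℕ) : ℝ) := by
      rw [nsmul_eq_mul]
      push_cast
      ring
    _ ≤ 1 := div_le_one_of_le₀ h3 (by positivity)

theorem IsNSol.coprime_of_le_log {N x y m n : ℕ} (hx : IsNSol N x m) (hy : IsNSol N y n)
    (hxy : x < y) (hN : 63 ≤ Nat.log 2 N) (hyN : y ≤ Nat.log 2 N + 1) : x.Coprime y := by
  by_contra hc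
  have h1 := hx.pow_lt_of_not_coprime hy hxy hc
  set L := Nat.log 2 N + 1 with hL
  set l := Nat.log 2 L with hl
  have hl6 : 6 ≤ l := Nat.le_log_of_pow_le (by norm_num) (by norm_num; omega)
  have hlL : 2 ^ l ≤ L := Nat.pow_log_le_self 2 (by omega)
  have hLl : L < 2 ^ (l + 1) := Nat.lt_pow_succ_log_self (by norm_num) L
  have hnl : n ≤ l := Nat.le_log_of_pow_le (by norm_num) (by omega)
  have h2 : N < 2 ^ ((l + 1) * l) :=
    calc N < y ^ n := hy.lt_pow
      _ ≤ (2 ^ (l + 1)) ^ n := Nat.pow_le_pow_left (by omega) n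
      _ ≤ (2 ^ (l + 1)) ^ l := Nat.pow_le_pow_right (by positivity) hnl
      _ = _ := (pow_mul _ _ _).symm
  have hN0 : N ≠ 0 := by
    rintro rfl
    simp at hN
  have h3 := Nat.log_lt_of_lt_pow hN0 h2
  have h4 := mul_succ_lt_two_pow hl6
  omega

theorem sum_one_div_le_of_coprime {y Y : ℕ} (hy : 3 ≤ y) (s : Finset ℕ)
    (hs : ∀ z ∈ s, y ≤ z ∧ z ≤ Y) (hc : ∀ z ∈ s, ∀ w ∈ s, z < w → z.Coprime w) :
    ∑ z ∈ s, (1 : ℝ) / z ≤ 1 / 2 + ∑ p ∈ (Finset.Icc y Y).filter Nat.Prime, (1 : ℝ) / p := by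
  have hy0 : (0 : ℝ) < y := by exact_mod_cast (by omega : 0 < y)
  have hprime : ∀ z ∈ s, z.minFac.Prime := fun z hz =>
    Nat.minFac_prime (by have := (hs z hz).1; omega)
  have hinj : Set.InjOn Nat.minFac (s : Set ℕ) := by
    intro z hz w hw hzw
    by_contra hne
    wlog h : z < w generalizing z w
    · exact this hw hz hzw.symm (Ne.symm hne) (by omega)
    have := Nat.dvd_gcd z.minFac_dvd (hzw ▸ w.minFac_dvd)
    rw [hc z hz w hw h] at this
    exact (hprime z hz).one_lt.ne' (Nat.dvd_one.1 this)
  let f : ℕ → ℝ := fun p => if p < y then 1 / y else 1 / p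
  have hf : ∀ p, 0 ≤ f p := fun p => by
    simp only [f]
    split_ifs <;> positivity
  calc ∑ z ∈ s, (1 : ℝ) / z ≤ ∑ z ∈ s, f z.minFac := by
        refine Finset.sum_le_sum fun z hz => ?_
        have h1 := (hs z hz).1
        simp only [f]
        split_ifs
        · exact one_div_le_one_div_of_le hy0 (by exact_mod_cast h1)
        · exact one_div_le_one_div_of_le (by exact_mod_cast (hprime z hz).pos)
            (by exact_mod_cast Nat.minFac_le (by omega))
    _ = ∑ p ∈ s.image Nat.minFac, f p := (Finset.sum_image hinj).symm
    _ ≤ ∑ p ∈ y.primesBelow ∪ (Finset.Icc y Y).filter Nat.Prime, f p := by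
        refine Finset.sum_le_sum_of_subset_of_nonneg (fun p hp => ?_) fun p _ _ => hf p
        obtain ⟨z, hz, rfl⟩ := Finset.mem_image.1 hp
        have h1 : z.minFac ≤ z := Nat.minFac_le (by have := (hs z hz).1; omega)
        have h2 := (hs z hz).2
        simp only [Finset.mem_union, Nat.mem_primesBelow, Finset.mem_filter, Finset.mem_Icc,
          hprime z hz, and_true]
        omega
    _ ≤ ∑ p ∈ y.primesBelow, f p + ∑ p ∈ (Finset.Icc y Y).filter Nat.Prime, f p := by
        rw [← Finset.sum_union_inter]
        exact le_add_of_nonneg_right (Finset.sum_nonneg fun p _ => hf p)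
    _ = y.primesBelow.card / y + ∑ p ∈ (Finset.Icc y Y).filter Nat.Prime, (1 : ℝ) / p := by
        congr 1
        · rw [Finset.sum_congr rfl fun p hp => if_pos (Nat.lt_of_mem_primesBelow hp)]
          simp [div_eq_mul_inv]
        · refine Finset.sum_congr rfl fun p hp => if_neg ?_
          have := (Finset.mem_Icc.1 (Finset.mem_filter.1 hp).1).1
          omega
    _ ≤ _ := by
        refine add_le_add_left ?_ _
        have h : 2 * (y.primesBelow.card : ℝ) ≤ y := by
          exact_mod_cast two_mul_card_primesBelow_le (by omega)
        rw [div_le_iff₀ hy0]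
        linarith

theorem sum_one_div_lt {N x₁ m₁ : ℕ} (h₁ : IsNSol N x₁ m₁) (s : Finset ℕ)
    (hs : ∀ z ∈ s, x₁ < z ∧ ∃ n, IsNSol N z n) : ∑ z ∈ s, (1 : ℝ) / z < 5.9037 := by
  rcases s.eq_empty_or_nonempty with rfl | hne
  · norm_num
  have hx₁ := h₁.1
  obtain ⟨L, hL⟩ : ∃ L, L = Nat.log 2 N + 1 := ⟨_, rfl⟩
  obtain ⟨y, hy, hmin⟩ : ∃ y ∈ s, ∀ z ∈ s, y ≤ z := ⟨s.min' hne, s.min'_mem hne, s.min'_le⟩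
  obtain ⟨hxy, n, hn⟩ := hs y hy
  have hLy : L ≤ y ^ 36 := hL ▸ h₁.log_two_lt hn hxy
  rw [← Finset.sum_filter_add_sum_filter_not s (fun z => z ≤ L)]
  have hbig : ∀ k : ℕ, 2 ^ k ≤ L + 1 →
      k * ∑ z ∈ s.filter (fun z => ¬ z ≤ L), (1 : ℝ) / z ≤ 1 := fun k hk => by
    refine sum_one_div_le_of_lt (N := N) _ (fun z hz => (hs z (Finset.mem_filter.1 hz).1).2)
      (fun z hz => ?_) fun z hz => ?_ <;>
    · have := (Finset.mem_filter.1 hz).2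
      omega
  rcases lt_or_ge L 64 with hL64 | hL64
  · have h1 := hbig 1 (by omega)
    have h2 : ∑ z ∈ s.filter (fun z => z ≤ L), (1 : ℝ) / z ≤
        ∑ z ∈ Finset.Icc (3 : ℕ) 63, (1 : ℝ) / z := by
      refine Finset.sum_le_sum_of_subset_of_nonneg (fun z hz => ?_) fun z _ _ => by positivity
      obtain ⟨hz, hzL⟩ := Finset.mem_filter.1 hz
      have := (hs z hz).1
      exact Finset.mem_Icc.2 ⟨by omega, by omega⟩
    have h3 : ∑ z ∈ Finset.Icc (3 : ℕ) 63, (1 : ℝ) / z ≤ 3.25 := by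
      norm_num [Finset.sum_Icc_succ_top]
    rw [Nat.cast_one, one_mul] at h1
    norm_num1 at h3 ⊢
    linarith
  · have h1 := hbig 6 (by omega)
    have h2 := sum_one_div_le_of_coprime (y := y) (Y := L) (by omega)
      (s.filter fun z => z ≤ L)
      (fun z hz => ⟨hmin z (Finset.mem_filter.1 hz).1, (Finset.mem_filter.1 hz).2⟩)
      (fun z hz w hw hzw => by
        obtain ⟨hz, -⟩ := Finset.mem_filter.1 hz
        obtain ⟨hw, hwL⟩ := Finset.mem_filter.1 hw
        obtain ⟨-, a, ha⟩ := hs z hz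
        obtain ⟨-, b, hb⟩ := hs w hw
        exact ha.coprime_of_le_log hb hzw (by omega) (by omega))
    have h3 := sum_primes_Icc_inv_le_of_le_pow (by omega) hLy
    push_cast at h1
    linarith

open scoped Classical in
theorem stmt0 (N x₁ m₁ : ℕ) (hN : 2 ≤ N) (h₁ : IsNSol N x₁ m₁)
    (hmin : ∀ x m : ℕ, IsNSol N x m → x₁ ≤ x) :
    ∑ x ∈ (Finset.range (N + 1)).filter (fun x => x₁ < x ∧ ∃ m, IsNSol N x m),
      (1 : ℝ) / x < 5.9037 := by
  refine sum_one_div_lt h₁ _ fun z hz => ?_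
  exact (Finset.mem_filter.1 hz).2
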